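/- arXiv:1803.11411 — 2 statements merged into one kernel-verified Lean document; each statement's English description precedes it below -/
import Mathlib

section
/- Let A_c ∈ ℝ^{p×p} be Hurwitz, B_c ∈ ℝ^{p×s}, C_c ∈ ℝ^{r×p}, D_c ∈ ℝ^{r×s}, and S̄ ∈ ℝ^{s×s}, and suppose there exists X_c ∈ ℝ^{p×s} satisfying the linear matrix equations A_cX_c + B_c = X_cS̄ and C_cX_c + D_c = 0. Then for any differentiable functions x_c : ℝ → ℝ^p and Ω : ℝ → ℝ^s satisfying x_c'(t) = A_cx_c(t) + B_cΩ(t) and Ω'(t) = S̄Ω(t) for all t ≥ 0, the error e(t) = C_cx_c(t) + D_cΩ(t) tends to 0 as t → ∞. -/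
open Matrix Filter

/-- A real square matrix is Hurwitz if every complex eigenvalue (root of the
characteristic polynomial of its complexification) has negative real part. -/
def IsHurwitz {n : Type*} [Fintype n] [DecidableEq n] (M : Matrix n n ℝ) : Prop :=
  ∀ μ : ℂ, (M.map Complex.ofReal).charpoly.IsRoot μ → μ.re < 0

/-- A matrix applied to a differentiable vector-valued function can be differentiated inside. -/
theorem HasDerivAt.matrix_mulVec {𝕜 m n : Type*} [RCLike 𝕜] [Fintype m] [Fintype n]
    (M : Matrix m n 𝕜) {f : ℝ → n → 𝕜} {f' : n → 𝕜} {t : ℝ} (hf : HasDerivAt f f' t) :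
    HasDerivAt (fun t => M.mulVec (f t)) (M.mulVec f') t :=
  ((LinearMap.toContinuousLinearMap
    (M.mulVecLin.restrictScalars ℝ)).hasFDerivAt (x := f t)).comp_hasDerivAt t hf

/-- A solution of `w' = μ w + g` with `μ.re < 0` and a forcing term `g` vanishing at infinity
vanishes at infinity. -/
theorem tendsto_zero_of_hasDerivAt_smul_add {E : Type*} [NormedAddCommGroup E] [NormedSpace ℂ E]
    {μ : ℂ} (hμ : μ.re < 0) {w g : ℝ → E}
    (hw : ∀ t : ℝ, 0 ≤ t → HasDerivAt w (μ • w t + g t) t) (hg : Tendsto g atTop (nhds 0)) :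
    Tendsto w atTop (nhds 0) := by
  obtain ⟨a, ha⟩ : ∃ a : ℝ, a = -μ.re := ⟨_, rfl⟩
  have ha0 : 0 < a := by linarith
  have hnorm (t : ℝ) : ‖Complex.exp (-μ * t)‖ = Real.exp (a * t) := by
    simp [Complex.norm_exp, ha]
  have hderiv (t : ℝ) (ht : 0 ≤ t) : HasDerivAt (fun t : ℝ => Complex.exp (-μ * t) • w t)
      (Complex.exp (-μ * t) • g t) t := by
    have h1 : HasDerivAt (fun t : ℝ => Complex.exp (-μ * t)) (Complex.exp (-μ * t) * -μ) t := by
      simpa using ((Complex.ofRealCLM.hasDerivAt (x := t)).const_mul (-μ)).cexp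
    refine (h1.smul (hw t ht)).congr_deriv ?_
    module
  rw [NormedAddGroup.tendsto_nhds_zero]
  intro ε hε
  have hg' := (NormedAddGroup.tendsto_nhds_zero.1 hg) (a * (ε / 2)) (by positivity)
  obtain ⟨T, hT⟩ := eventually_atTop.1 (hg'.and (eventually_ge_atTop 0))
  have hT0 : 0 ≤ T := (hT T le_rfl).2
  obtain ⟨K, hK⟩ : ∃ K : ℝ, K = ‖Complex.exp (-μ * T) • w T‖ := ⟨_, rfl⟩
  have hbound (t : ℝ) (ht : T ≤ t) :
      ‖Complex.exp (-μ * t) • w t‖ ≤ K + ε / 2 * (Real.exp (a * t) - Real.exp (a * T)) := by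
    refine image_norm_le_of_norm_deriv_right_le_deriv_boundary
      (f' := fun t : ℝ => Complex.exp (-μ * t) • g t)
      (B := fun t => K + ε / 2 * (Real.exp (a * t) - Real.exp (a * T)))
      (B' := fun t => a * (ε / 2) * Real.exp (a * t)) (a := T) (b := t)
      (fun x hx => (hderiv x (hT0.trans hx.1)).continuousAt.continuousWithinAt)
      (fun x hx => (hderiv x (hT0.trans hx.1)).hasDerivWithinAt) (by simp [hK])
      (fun x => ?_) (fun x hx => ?_) ⟨ht, le_rfl⟩
    · have h1 : HasDerivAt (fun x => Real.exp (a * x)) (Real.exp (a * x) * a) x := by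
        simpa using ((hasDerivAt_id x).const_mul a).exp
      refine (((h1.sub_const _).const_mul (ε / 2)).const_add K).congr_deriv ?_
      ring
    · rw [norm_smul, hnorm, mul_comm]
      gcongr
      exact (hT x hx.1).1.le
  have hdecay : Tendsto (fun t => K * Real.exp (-(a * t))) atTop (nhds 0) := by
    simpa using (Real.tendsto_exp_neg_atTop_nhds_zero.comp
      (tendsto_id.const_mul_atTop ha0)).const_mul K
  filter_upwards [hdecay.eventually (gt_mem_nhds (half_pos hε)), eventually_ge_atTop T]
    with t htK htT
  have hb := hbound t htT
  rw [norm_smul, hnorm] at hb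
  have hpos := Real.exp_pos (a * t)
  rw [Real.exp_neg, ← div_eq_mul_inv, div_lt_iff₀ hpos] at htK
  have hposT := mul_pos (half_pos hε) (Real.exp_pos (a * T))
  refine lt_of_mul_lt_mul_left ?_ hpos.le
  linarith

/-- A solution of `z' = A z` annihilated by a product of factors `A - μ` with `μ.re < 0`
vanishes at infinity. -/
theorem tendsto_zero_of_aeval_prod_mulVec_eq_zero {n : Type*} [Fintype n] [DecidableEq n]
    (A : Matrix n n ℂ) (s : Multiset ℂ) (hs : ∀ μ ∈ s, μ.re < 0) (z : ℝ → n → ℂ)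
    (hz : ∀ t : ℝ, 0 ≤ t → HasDerivAt z (A.mulVec (z t)) t)
    (hzero : ∀ t : ℝ, 0 ≤ t → (Polynomial.aeval A
      (s.map fun μ => Polynomial.X - Polynomial.C μ).prod).mulVec (z t) = 0) :
    Tendsto z atTop (nhds 0) := by
  induction s using Multiset.induction_on generalizing z with
  | empty =>
    refine tendsto_const_nhds.congr' ?_
    filter_upwards [eventually_ge_atTop 0] with t ht
    simpa using (hzero t ht).symm
  | cons μ s ih =>
    refine tendsto_zero_of_hasDerivAt_smul_add (hs μ (Multiset.mem_cons_self μ s))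
      (g := fun t => (A - algebraMap ℂ _ μ).mulVec (z t)) (fun t ht => ?_)
      (ih (fun ν hν => hs ν (Multiset.mem_cons_of_mem hν)) _ (fun t ht => ?_) (fun t ht => ?_))
    · refine (hz t ht).congr_deriv ?_
      simp [sub_mulVec, Algebra.algebraMap_eq_smul_one, smul_mulVec]
    · refine ((hz t ht).matrix_mulVec _).congr_deriv ?_
      rw [mulVec_mulVec, mulVec_mulVec, sub_mul, mul_sub, Algebra.commutes μ A]
    · have h := hzero t ht
      rw [Multiset.map_cons, Multiset.prod_cons, mul_comm, map_mul, ← mulVec_mulVec] at h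
      simpa using h

/-- Every solution of `z' = A z` with `A` Hurwitz vanishes at infinity. -/
theorem IsHurwitz.tendsto_zero {n : Type*} [Fintype n] [DecidableEq n] {A : Matrix n n ℝ}
    (hA : IsHurwitz A) {z : ℝ → n → ℝ}
    (hz : ∀ t : ℝ, 0 ≤ t → HasDerivAt z (A.mulVec (z t)) t) :
    Tendsto z atTop (nhds 0) := by
  have hmonic := (A.map Complex.ofReal).charpoly_monic
  have hc : Tendsto (fun t i => (z t i : ℂ)) atTop (nhds 0) := by
    refine tendsto_zero_of_aeval_prod_mulVec_eq_zero (A.map Complex.ofReal)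
      (A.map Complex.ofReal).charpoly.roots
      (fun μ hμ => hA μ ((Polynomial.mem_roots hmonic.ne_zero).1 hμ)) _ (fun t ht => ?_)
      (fun t _ => ?_)
    · refine hasDerivAt_pi.2 fun i => ?_
      refine ((hasDerivAt_pi.1 (hz t ht) i).ofReal_comp).congr_deriv ?_
      simp [mulVec, dotProduct]
    · rw [← (IsAlgClosed.splits _).eq_prod_roots_of_monic hmonic, aeval_self_charpoly,
        zero_mulVec]
  rw [tendsto_pi_nhds] at hc ⊢
  intro i
  simpa [Function.comp_def] using (Complex.continuous_re.tendsto _).comp (hc i)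

/-- **Lemma 3.** If `A_c` is Hurwitz and `X_c` solves the regulator equations
`A_cX_c + B_c = X_cS̄` and `C_cX_c + D_c = 0`, then for any trajectory of the closed-loop
system `x_c' = A_cx_c + B_cΩ`, `Ω' = S̄Ω` (for `t ≥ 0`), the error
`e = C_cx_c + D_cΩ` tends to `0` as `t → ∞`. -/
theorem regulator_equations_imply_error_convergence (p s r : ℕ)
    (Ac : Matrix (Fin p) (Fin p) ℝ) (Bc : Matrix (Fin p) (Fin s) ℝ)
    (Cc : Matrix (Fin r) (Fin p) ℝ) (Dc : Matrix (Fin r) (Fin s) ℝ)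
    (Sbar : Matrix (Fin s) (Fin s) ℝ)
    (hAc : IsHurwitz Ac)
    (Xc : Matrix (Fin p) (Fin s) ℝ)
    (hreg1 : Ac * Xc + Bc = Xc * Sbar)
    (hreg2 : Cc * Xc + Dc = 0)
    (xc : ℝ → Fin p → ℝ) (Ω : ℝ → Fin s → ℝ)
    (hxc : Differentiable ℝ xc) (hΩ : Differentiable ℝ Ω)
    (hxc' : ∀ t : ℝ, 0 ≤ t → HasDerivAt xc (Ac.mulVec (xc t) + Bc.mulVec (Ω t)) t)
    (hΩ' : ∀ t : ℝ, 0 ≤ t → HasDerivAt Ω (Sbar.mulVec (Ω t)) t) :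
    Tendsto (fun t : ℝ => Cc.mulVec (xc t) + Dc.mulVec (Ω t)) atTop (nhds 0) := by
  have hz : ∀ t : ℝ, 0 ≤ t → HasDerivAt (fun t => xc t - Xc.mulVec (Ω t))
      (Ac.mulVec (xc t - Xc.mulVec (Ω t))) t := by
    intro t ht
    refine ((hxc' t ht).sub ((hΩ' t ht).matrix_mulVec Xc)).congr_deriv ?_
    rw [mulVec_mulVec, ← hreg1, add_mulVec, mulVec_sub, mulVec_mulVec]
    abel
  have he : (fun t => Cc.mulVec (xc t) + Dc.mulVec (Ω t)) =
      fun t => Cc.mulVec (xc t - Xc.mulVec (Ω t)) := by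
    funext t
    rw [eq_neg_of_add_eq_zero_right hreg2, neg_mulVec, mulVec_sub, mulVec_mulVec, sub_eq_add_neg]
  have hcont : Continuous fun v => Cc.mulVec v := continuous_const.matrix_mulVec continuous_id
  rw [he]
  simpa [Function.comp_def] using (hcont.tendsto 0).comp (hAc.tendsto_zero hz)
end

section
/- Let Z ∈ ℝ^{q̄×q̄} be Hurwitz, ε > 0, and let Z₁ : ℝ → ℝ^{q̄×q̄} and Z₂ : ℝ → ℝ^{q̄} be continuous functions that decay to zero exponentially, i.e., there exist c > 0 and α > 0 with ‖Z₁(t)‖ ≤ c·e^{−αt} and ‖Z₂(t)‖ ≤ c·e^{−αt} for all t ≥ 0. Then every differentiable function υ : ℝ → ℝ^{q̄} satisfying υ'(t) = εZυ(t) + Z₁(t)υ(t) + Z₂(t) for all t ≥ 0 decays to zero exponentially. -/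
open Matrix

/-- Every endomorphism of a finite-dimensional complex space whose eigenvalues have negative real
part is strictly dissipative with respect to a suitable inner product. -/
theorem exists_injective_re_inner_le_of_eigenvalues_re_neg (n : ℕ) :
    ∀ (E : Type) [AddCommGroup E] [Module ℂ E] [FiniteDimensional ℂ E] (f : Module.End ℂ E),
      Module.finrank ℂ E = n → (∀ μ : ℂ, f.HasEigenvalue μ → μ.re < 0) →
      ∃ (F : Type) (_ : NormedAddCommGroup F) (_ : InnerProductSpace ℂ F) (S : E →ₗ[ℂ] F),
        Function.Injective S ∧ ∃ β > (0 : ℝ), ∀ x,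
          (inner ℂ (S x) (S (f x))).re ≤ -β * ‖S x‖ ^ 2 := by
  induction n with
  | zero =>
    intro E _ _ _ f hE _
    have : Subsingleton E := Module.finrank_zero_iff.mp hE
    exact ⟨ℂ, inferInstance, inferInstance, 0, Function.injective_of_subsingleton _, 1, one_pos,
      by simp⟩
  | succ n ih =>
    intro E _ _ _ f hE hf
    have : Nontrivial E := Module.nontrivial_of_finrank_pos (R := ℂ) (by omega)
    obtain ⟨μ, hμ⟩ := Module.End.exists_eigenvalue f
    have hlt : LinearMap.range (f - algebraMap ℂ _ μ) < ⊤ := by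
      rw [lt_top_iff_ne_top]
      intro h
      have hinj := LinearMap.injective_iff_surjective.mpr (LinearMap.range_eq_top.mp h)
      obtain ⟨x, hx⟩ := hμ.exists_hasEigenvector
      refine hx.2 (hinj ?_)
      simp [hx.apply_eq_smul]
    obtain ⟨φ, hφ, hφle⟩ := Submodule.exists_le_ker_of_lt_top _ hlt
    have hφf : ∀ x, φ (f x) = μ * φ x := by
      intro x
      have := hφle (LinearMap.mem_range_self (f - algebraMap ℂ _ μ) x)
      simpa [sub_eq_zero] using this
    obtain ⟨v, hv⟩ : ∃ v, φ v = 1 := by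
      obtain ⟨v, hv⟩ := LinearMap.surjective hφ 1
      exact ⟨v, hv⟩
    have hW : ∀ x ∈ LinearMap.ker φ, f x ∈ LinearMap.ker φ := by
      intro x hx
      simp_all
    have hrank : Module.finrank ℂ (LinearMap.ker φ) = n := by
      have h1 := LinearMap.finrank_range_add_finrank_ker φ
      rw [LinearMap.range_eq_top.mpr (LinearMap.surjective hφ), finrank_top,
        Module.finrank_self] at h1
      omega
    obtain ⟨F, _, _, S, hS, β, hβ, hSβ⟩ := ih (LinearMap.ker φ) (f.restrict hW) hrank (by
      intro ν hν
      obtain ⟨x, hx⟩ := hν.exists_hasEigenvector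
      refine hf ν (Module.End.hasEigenvalue_of_hasEigenvector (x := (x : E)) ?_)
      refine ⟨Module.End.mem_eigenspace_iff.mpr ?_, fun h => hx.2 (Subtype.ext h)⟩
      exact congrArg Subtype.val hx.apply_eq_smul)
    let p : E →ₗ[ℂ] LinearMap.ker φ :=
      (LinearMap.id - φ.smulRight v).codRestrict _ (by intro x; simp [hv])
    have hp : ∀ x, (p x : E) = x - φ x • v := fun x => rfl
    have hpf : ∀ x, p (f x) = f.restrict hW (p x) + φ x • p (f v) := by
      intro x
      apply Subtype.ext
      simp only [hp, hφf, hv, Submodule.coe_add, Submodule.coe_smul, LinearMap.coe_restrict_apply,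
        map_sub, map_smul, mul_one]
      module
    have hμ' := hf μ hμ
    set k := ‖S (p (f v))‖
    obtain ⟨R, hR0, hR⟩ : ∃ R : ℝ, 0 < R ∧ k ^ 2 / (2 * β) ≤ R ^ 2 * (-μ.re / 2) := by
      refine ⟨1 + k ^ 2 / (β * -μ.re), by have := neg_pos.mpr hμ'; positivity, ?_⟩
      have h0 : 0 ≤ k ^ 2 / (β * -μ.re) := by have := neg_pos.mpr hμ'; positivity
      have h1 : k ^ 2 / (2 * β) = k ^ 2 / (β * -μ.re) * (-μ.re / 2) := by
        have := hμ'.ne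
        field_simp
      rw [h1]
      exact mul_le_mul_of_nonneg_right (by nlinarith) (by linarith)
    let T : E →ₗ[ℂ] WithLp 2 (F × ℂ) :=
      (WithLp.linearEquiv 2 ℂ (F × ℂ)).symm.toLinearMap ∘ₗ ((S ∘ₗ p).prod ((R : ℂ) • φ))
    have hT : ∀ x, T x = WithLp.toLp 2 (S (p x), (R : ℂ) * φ x) := fun x => rfl
    refine ⟨WithLp 2 (F × ℂ), inferInstance, inferInstance, T, ?_, min (β / 2) (-μ.re / 2),
      lt_min (by linarith) (by linarith), ?_⟩
    · rw [injective_iff_map_eq_zero]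
      intro x hx
      have h := congrArg WithLp.ofLp ((hT x).symm.trans hx)
      have h1 : S (p x) = 0 := congrArg Prod.fst h
      have h2 : (R : ℂ) * φ x = 0 := congrArg Prod.snd h
      have h3 : φ x = 0 := by simpa [hR0.ne'] using h2
      have h4 := congrArg Subtype.val ((map_eq_zero_iff S hS).mp h1)
      simpa [hp, h3] using h4
    · intro x
      have hin : (inner ℂ (T x) (T (f x))).re = (inner ℂ (S (p x)) (S (f.restrict hW (p x)))).re
          + (inner ℂ (S (p x)) (φ x • S (p (f v)))).re + R ^ 2 * μ.re * ‖φ x‖ ^ 2 := by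
        rw [hT, hT, WithLp.prod_inner_apply, hpf, hφf, map_add, map_smul, inner_add_right]
        simp only [Complex.add_re, RCLike.inner_apply, ← Complex.normSq_eq_norm_sq,
          Complex.normSq_apply, Complex.mul_re, Complex.mul_im, map_mul, Complex.conj_re,
          Complex.conj_im, Complex.ofReal_re, Complex.ofReal_im]
        ring
      have hno : ‖T x‖ ^ 2 = ‖S (p x)‖ ^ 2 + R ^ 2 * ‖φ x‖ ^ 2 := by
        rw [hT, WithLp.prod_norm_sq_eq_of_L2]
        simp [mul_pow]
      have hcs : (inner ℂ (S (p x)) (φ x • S (p (f v)))).re ≤ ‖S (p x)‖ * (‖φ x‖ * k) := by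
        rw [← norm_smul]
        exact (Complex.re_le_norm _).trans (norm_inner_le_norm _ _)
      have hamgm : ‖S (p x)‖ * (‖φ x‖ * k) ≤
          β / 2 * ‖S (p x)‖ ^ 2 + k ^ 2 / (2 * β) * ‖φ x‖ ^ 2 := by
        have h : β / 2 * ‖S (p x)‖ ^ 2 + k ^ 2 / (2 * β) * ‖φ x‖ ^ 2 - ‖S (p x)‖ * (‖φ x‖ * k)
            = (β * ‖S (p x)‖ - ‖φ x‖ * k) ^ 2 / (2 * β) := by
          field_simp
          ring
        have : 0 ≤ (β * ‖S (p x)‖ - ‖φ x‖ * k) ^ 2 / (2 * β) := by positivity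
        linarith
      have hR' := mul_le_mul_of_nonneg_right hR (sq_nonneg ‖φ x‖)
      have hb1 := mul_le_mul_of_nonneg_right (min_le_left (β / 2) (-μ.re / 2))
        (sq_nonneg ‖S (p x)‖)
      have hb2 := mul_le_mul_of_nonneg_right (min_le_right (β / 2) (-μ.re / 2))
        (mul_nonneg (sq_nonneg R) (sq_nonneg ‖φ x‖))
      have := hSβ (p x)
      rw [hin, hno]
      linarith

/-- A Hurwitz matrix is strictly dissipative with respect to a suitable inner product. -/
theorem IsHurwitz.exists_injective_inner_le {q : ℕ} {Z : Matrix (Fin q) (Fin q) ℝ}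
    (hZ : IsHurwitz Z) :
    ∃ (F : Type) (_ : NormedAddCommGroup F) (_ : InnerProductSpace ℝ F)
      (L : (Fin q → ℝ) →ₗ[ℝ] F), Function.Injective L ∧ ∃ β > (0 : ℝ), ∀ x,
        inner ℝ (L x) (L (Z *ᵥ x)) ≤ -β * ‖L x‖ ^ 2 := by
  obtain ⟨F, _, _, S, hS, β, hβ, h⟩ := exists_injective_re_inner_le_of_eigenvalues_re_neg _
    (Fin q → ℂ) (Matrix.toLin' (Z.map Complex.ofReal)) rfl (by
      intro μ hμ
      refine hZ μ ?_
      rw [← Matrix.charpoly_toLin']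
      exact (Module.End.hasEigenvalue_iff_isRoot_charpoly _ _).mp hμ)
  let c : (Fin q → ℝ) →ₗ[ℝ] (Fin q → ℂ) := Complex.ofRealCLM.toLinearMap.compLeft (Fin q)
  have hc : ∀ x i, c x i = (x i : ℂ) := fun x i => rfl
  refine ⟨F, inferInstance, InnerProductSpace.complexToReal, S.restrictScalars ℝ ∘ₗ c, ?_, β, hβ,
    fun x => ?_⟩
  · refine hS.comp fun x y hxy => funext fun i => ?_
    simpa [hc] using congrFun hxy i
  · have hcZ : c (Z *ᵥ x) = Matrix.toLin' (Z.map Complex.ofReal) (c x) := by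
      ext i
      simp [hc, Matrix.mulVec, dotProduct]
    have := h (c x)
    rw [← hcZ] at this
    exact this

/-- A nonnegative solution of `V' ≤ -b V + K e^{-αt} (V + 1)` decays exponentially. -/
theorem exists_exp_bound_of_deriv_le {V V' : ℝ → ℝ} {b K α : ℝ} (hb : 0 < b) (hK : 0 ≤ K)
    (hα : 0 < α) (hV0 : ∀ t, 0 ≤ V t) (hV : ∀ t, 0 ≤ t → HasDerivAt V (V' t) t)
    (hle : ∀ t, 0 ≤ t → V' t ≤ -b * V t + K * Real.exp (-α * t) * (V t + 1)) :
    ∃ C > (0 : ℝ), ∃ γ > (0 : ℝ), ∀ t, 0 ≤ t → V t ≤ C * Real.exp (-γ * t) := by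
  set γ := min b (α / 2)
  have hγ : 0 < γ := lt_min hb (by linarith)
  have hγb : γ ≤ b := min_le_left _ _
  have hγα : γ ≤ α / 2 := min_le_right _ _
  set D := K * Real.exp (K / α)
  have hD : 0 ≤ D := by positivity
  let g : ℝ → ℝ := fun t => γ * t + K / α * Real.exp (-α * t)
  let W : ℝ → ℝ := fun t => V t * Real.exp (g t) + 2 * D / α * Real.exp (-(α / 2) * t)
  have hexp : ∀ a t : ℝ, HasDerivAt (fun s => Real.exp (a * s)) (a * Real.exp (a * t)) t := by
    intro a t
    simpa [mul_comm] using ((hasDerivAt_id t).const_mul a).exp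
  have hg : ∀ t, HasDerivAt g (γ - K * Real.exp (-α * t)) t := by
    intro t
    refine (((hasDerivAt_id t).const_mul γ).add ((hexp (-α) t).const_mul (K / α))).congr_deriv ?_
    field_simp
    ring
  have hW : ∀ t, 0 ≤ t → HasDerivAt W (V' t * Real.exp (g t)
      + V t * (Real.exp (g t) * (γ - K * Real.exp (-α * t)))
      + 2 * D / α * (-(α / 2) * Real.exp (-(α / 2) * t))) t := fun t ht =>
    ((hV t ht).mul (hg t).exp).add ((hexp _ t).const_mul _)
  have hanti : AntitoneOn W (Set.Ici 0) := by
    refine antitoneOn_of_deriv_nonpos (convex_Ici 0)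
      (fun t ht => (hW t ht).continuousAt.continuousWithinAt) ?_ ?_
    · intro t ht
      rw [interior_Ici] at ht
      exact (hW t ht.le).differentiableAt.differentiableWithinAt
    · intro t ht
      rw [interior_Ici] at ht
      have ht' : 0 ≤ t := ht.le
      rw [(hW t ht').deriv]
      have h1 : Real.exp (-α * t) * Real.exp (g t) ≤
          Real.exp (K / α) * Real.exp (-(α / 2) * t) := by
        rw [← Real.exp_add, ← Real.exp_add]
        refine Real.exp_le_exp.mpr ?_
        have h2 : K / α * Real.exp (-α * t) ≤ K / α :=
          mul_le_of_le_one_right (by positivity) (Real.exp_le_one_iff.mpr (by nlinarith))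
        have h3 := mul_le_mul_of_nonneg_right hγα ht'
        simp only [g]
        linarith
      have h2 := mul_le_mul_of_nonneg_left h1 hK
      have h3 := mul_le_mul_of_nonneg_right (hle t ht') (Real.exp_pos (g t)).le
      have h4 : 0 ≤ (b - γ) * (V t * Real.exp (g t)) :=
        mul_nonneg (by linarith) (mul_nonneg (hV0 t) (Real.exp_pos _).le)
      have h5 : 2 * D / α * (-(α / 2) * Real.exp (-(α / 2) * t)) =
          -(K * (Real.exp (K / α) * Real.exp (-(α / 2) * t))) := by
        simp only [D]
        field_simp
      rw [h5]
      linarith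
  have hW0 : 0 ≤ W 0 := by
    have := hV0 0
    positivity
  refine ⟨W 0 + 1, by linarith, γ, hγ, fun t ht => ?_⟩
  have h1 : W t ≤ W 0 := hanti Set.self_mem_Ici ht ht
  have h2 : V t * Real.exp (γ * t) ≤ W t := by
    have h3 : Real.exp (γ * t) ≤ Real.exp (g t) :=
      Real.exp_le_exp.mpr (le_add_of_nonneg_right (by positivity))
    have h4 := mul_le_mul_of_nonneg_left h3 (hV0 t)
    have h5 : 0 ≤ 2 * D / α * Real.exp (-(α / 2) * t) := by positivity
    simp only [W]
    linarith
  rw [neg_mul, Real.exp_neg, ← div_eq_mul_inv, le_div_iff₀ (Real.exp_pos _)]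
  linarith

/-- **Lemma 4 (Cai et al.).** If `Z` is Hurwitz, `ε > 0`, and `Z₁(t)`, `Z₂(t)` are
continuous and decay to zero exponentially, then every solution of
`υ' = εZυ + Z₁(t)υ + Z₂(t)` (for `t ≥ 0`) decays to zero exponentially. -/
theorem perturbed_linear_system_exp_decay (qb : ℕ)
    (Z : Matrix (Fin qb) (Fin qb) ℝ) (hZ : IsHurwitz Z)
    (ε : ℝ) (hε : 0 < ε)
    (Z₁ : ℝ → Matrix (Fin qb) (Fin qb) ℝ) (Z₂ : ℝ → (Fin qb → ℝ))
    (hZ₁cont : Continuous Z₁) (hZ₂cont : Continuous Z₂)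
    (hdecay : ∃ c > (0 : ℝ), ∃ α > (0 : ℝ), ∀ t : ℝ, 0 ≤ t →
      (∀ i j, |Z₁ t i j| ≤ c * Real.exp (-α * t)) ∧ ‖Z₂ t‖ ≤ c * Real.exp (-α * t))
    (υ : ℝ → (Fin qb → ℝ)) (hυ : Differentiable ℝ υ)
    (hode : ∀ t : ℝ, 0 ≤ t → HasDerivAt υ
      ((ε • Z).mulVec (υ t) + (Z₁ t).mulVec (υ t) + Z₂ t) t) :
    ∃ c > (0 : ℝ), ∃ α > (0 : ℝ), ∀ t : ℝ, 0 ≤ t →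
      ‖υ t‖ ≤ c * Real.exp (-α * t) := by
  obtain ⟨c, hc, α, hα, hdec⟩ := hdecay
  obtain ⟨F, _, _, L₀, hL₀, β, hβ, hdiss⟩ := hZ.exists_injective_inner_le
  let L : (Fin qb → ℝ) →L[ℝ] F := LinearMap.toContinuousLinearMap L₀
  have hL : ∀ x, L x = L₀ x := fun x => rfl
  obtain ⟨m, -, hm⟩ := L₀.exists_antilipschitzWith (LinearMap.ker_eq_bot.mpr hL₀)
  have hbd : ∀ x, ‖x‖ ≤ m * ‖L x‖ := fun x => by
    simpa [hL] using hm.le_mul_dist x 0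
  have hV : ∀ t, 0 ≤ t → HasDerivAt (fun s => ‖L (υ s)‖ ^ 2) (2 * inner ℝ (L (υ t))
      (L ((ε • Z).mulVec (υ t) + (Z₁ t).mulVec (υ t) + Z₂ t))) t := fun t ht =>
    (L.hasFDerivAt.comp_hasDerivAt t (hode t ht)).norm_sq
  have hZ₁ : ∀ t, 0 ≤ t → ‖(Z₁ t).mulVec (υ t)‖ ≤ qb * (c * Real.exp (-α * t)) * ‖υ t‖ := by
    intro t ht
    refine (pi_norm_le_iff_of_nonneg (by positivity)).mpr fun i => ?_
    calc ‖∑ j, Z₁ t i j * υ t j‖ ≤ ∑ j : Fin qb, c * Real.exp (-α * t) * ‖υ t‖ := by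
          refine norm_sum_le_of_le _ fun j _ => ?_
          rw [norm_mul]
          exact mul_le_mul ((hdec t ht).1 i j) (norm_le_pi_norm _ j) (norm_nonneg _)
            (by positivity)
      _ = qb * (c * Real.exp (-α * t)) * ‖υ t‖ := by simp [mul_assoc]
  obtain ⟨C, hC, γ, hγ, hVC⟩ := exists_exp_bound_of_deriv_le
    (b := 2 * ε * β) (K := 2 * ‖L‖ * c * qb * m + ‖L‖ * c) (by positivity) (by positivity) hα
    (fun t => sq_nonneg ‖L (υ t)‖) hV (by
      intro t ht
      have h1 : inner ℝ (L (υ t)) (L ((ε • Z).mulVec (υ t))) ≤ ε * (-β * ‖L (υ t)‖ ^ 2) := by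
        rw [Matrix.smul_mulVec, map_smul, inner_smul_right]
        exact mul_le_mul_of_nonneg_left (hdiss (υ t)) hε.le
      have h2 : inner ℝ (L (υ t)) (L ((Z₁ t).mulVec (υ t))) ≤
          ‖L (υ t)‖ * (‖L‖ * (qb * (c * Real.exp (-α * t)) * (m * ‖L (υ t)‖))) := by
        refine (real_inner_le_norm _ _).trans ?_
        gcongr
        refine (L.le_opNorm _).trans ?_
        gcongr
        refine (hZ₁ t ht).trans ?_
        gcongr
        exact hbd _
      have h3 : inner ℝ (L (υ t)) (L (Z₂ t)) ≤
          ‖L (υ t)‖ * (‖L‖ * (c * Real.exp (-α * t))) := by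
        refine (real_inner_le_norm _ _).trans ?_
        gcongr
        refine (L.le_opNorm _).trans ?_
        gcongr
        exact (hdec t ht).2
      have h4 : 0 ≤ (‖L (υ t)‖ - 1) ^ 2 * (‖L‖ * (c * Real.exp (-α * t))) := by positivity
      have h5 : 0 ≤ ‖L‖ * (qb * (c * Real.exp (-α * t)) * m) := by positivity
      rw [map_add, map_add, inner_add_right, inner_add_right]
      linarith)
  refine ⟨m * √C + 1, by positivity, γ / 2, by positivity, fun t ht => ?_⟩
  have hLt : ‖L (υ t)‖ ≤ √C * Real.exp (-(γ / 2) * t) := by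
    refine abs_le_of_sq_le_sq' ?_ (by positivity) |>.2
    rw [mul_pow, Real.sq_sqrt hC.le, ← Real.exp_nat_mul]
    refine (hVC t ht).trans_eq ?_
    congr 2
    push_cast
    ring
  calc ‖υ t‖ ≤ m * ‖L (υ t)‖ := hbd _
    _ ≤ m * (√C * Real.exp (-(γ / 2) * t)) := by gcongr
    _ ≤ (m * √C + 1) * Real.exp (-(γ / 2) * t) := by
      have := Real.exp_pos (-(γ / 2) * t)
      linarith
end
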